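/- arXiv:2011.08661 — 2 statements merged into one kernel-verified Lean document; each statement's English description precedes it below -/
import Mathlib

section
/- Let n ≥ 1 and for each i = 1, …, n let T_i ∈ {0,1}, π_i ∈ (0,1), π̂_i ∈ (0,1), and μ̂_i, r0_i, r1_i, ε0_i, ε1_i ∈ ℝ, and set Y_i := T_i·(r1_i + ε1_i) + (1 − T_i)·(r0_i + ε0_i). Define τ̂ := (1/n)·Σ_i [ T_i(Y_i − μ̂_i)/π̂_i − (1 − T_i)(Y_i − μ̂_i)/(1 − π̂_i) ], τ̄ := (1/n)·Σ_i (r1_i − r0_i), Q_A := −(1/n)·Σ_i [ T_iY_i/(π̂_iπ_i) + (1 − T_i)Y_i/((1 − π̂_i)(1 − π_i)) − μ̂_i/(π̂_i(1 − π̂_i)) ]·(π̂_i − π_i), Q_B := (1/n)·Σ_i (T_i − π_i)·[ μ̂_i/(π̂_iπ_i) − μ̂_i/((1 − π̂_i)(1 − π_i)) ]·(π̂_i − π_i), and Q_C := (1/n)·Σ_i [ r1_i/π_i + r0_i/(1 − π_i) − μ̂_i/(π_i(1 − π_i)) ]·(T_i − π_i) + (1/n)·Σ_i [ T_i·ε1_i/π_i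 − (1 − T_i)·ε0_i/(1 − π_i) ]. Then τ̂ − τ̄ = Q_A + Q_B + Q_C. -/
/-- the algebraic decomposition `τ̂ − τ̄ = Q_A + Q_B + Q_C` of the debiased
inverse propensity weighting estimator. -/
theorem dipw_decomposition
    (n : ℕ) (hn : 1 ≤ n)
    (T : Fin n → ℝ) (hTbin : ∀ i, T i = 0 ∨ T i = 1)
    (pi pih : Fin n → ℝ)
    (hpi : ∀ i, pi i ∈ Set.Ioo (0 : ℝ) 1) (hpih : ∀ i, pih i ∈ Set.Ioo (0 : ℝ) 1)
    (μh r0 r1 e0 e1 : Fin n → ℝ)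
    (Y : Fin n → ℝ)
    (hY : ∀ i, Y i = T i * (r1 i + e1 i) + (1 - T i) * (r0 i + e0 i)) :
    ((1 / (n : ℝ)) * ∑ i, (T i * (Y i - μh i) / pih i
        - (1 - T i) * (Y i - μh i) / (1 - pih i)))
      - (1 / (n : ℝ)) * ∑ i, (r1 i - r0 i)
    = (-(1 / (n : ℝ)) * ∑ i, (T i * Y i / (pih i * pi i)
          + (1 - T i) * Y i / ((1 - pih i) * (1 - pi i))
          - μh i / (pih i * (1 - pih i))) * (pih i - pi i))
      + ((1 / (n : ℝ)) * ∑ i, (T i - pi i) * (μh i / (pih i * pi i)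
          - μh i / ((1 - pih i) * (1 - pi i))) * (pih i - pi i))
      + ((1 / (n : ℝ)) * ∑ i, (r1 i / pi i + r0 i / (1 - pi i)
          - μh i / (pi i * (1 - pi i))) * (T i - pi i)
        + (1 / (n : ℝ)) * ∑ i, (T i * e1 i / pi i - (1 - T i) * e0 i / (1 - pi i))) := by
  simp only [neg_mul, ← mul_neg, ← Finset.sum_neg_distrib, ← mul_sub, ← mul_add,
    ← Finset.sum_sub_distrib, ← Finset.sum_add_distrib]
  congr 1
  refine Finset.sum_congr rfl fun i _ => ?_
  have hp : pi i ≠ 0 := (hpi i).1.ne'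
  have hp' : 1 - pi i ≠ 0 := (sub_pos.2 (hpi i).2).ne'
  have hq : pih i ≠ 0 := (hpih i).1.ne'
  have hq' : 1 - pih i ≠ 0 := (sub_pos.2 (hpih i).2).ne'
  rw [hY i]
  rcases hTbin i with h | h <;> rw [h] <;> field_simp <;> ring
end

section
/- Let ψ(u) := 1/(1 + e^{−u}) be the standard logistic function. Fix constants c_π ∈ (0, 1/2), c_π̂ ∈ (0, 1/2], and c_γ, c_1, c_2, c_μ̂, c_Y > 0. Then there exists a constant c_{δ1} > 0 depending only on these constants such that the following holds. Let n ≥ 1, p ≥ 2, s ≥ 1 be integers, let x_1, …, x_n ∈ ℝ^p, γ, γ̂ ∈ ℝ^p, T ∈ {0,1}^n, Y ∈ ℝ^n, μ̂ ∈ ℝ^n, and set π_i := ψ(x_i·γ), π̂_i := ψ(x_i·γ̂), and Ỹ_i := T_iY_i(1 − π̂_i)/π̂_i + (1 − T_i)Y_iπ̂_i/(1 − π̂_i). Suppose: (a) c_π < π_i < 1 − c_π and c_π̂ ≤ π̂_i ≤ 1 − c_π̂ for all i; (b) ‖γ̂ − γ‖₁ ≤ c_γ·s·√(log(p)/n); (c)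 ( (1/n)·Σ_i (x_i·(γ̂ − γ))⁴ )^{1/2} ≤ c_1·s·log(p)/n; (d) max_{1 ≤ j ≤ p} | (1/n)·Σ_i x_{ij}·(Ỹ_i − μ̂_i) | ≤ c_2·√(log(p)/n); (e) (1/n)·Σ_i μ̂_i² ≤ c_μ̂; (f) (1/n)·Σ_i Y_i² ≤ c_Y. Then the bias term Q_A := −(1/n)·Σ_i [ T_iY_i/(π̂_iπ_i) + (1 − T_i)Y_i/((1 − π̂_i)(1 − π_i)) − μ̂_i/(π̂_i(1 − π̂_i)) ]·(π̂_i − π_i) satisfies |Q_A| ≤ c_{δ1}·s·log(p)/n. -/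
/-- A quadratic bound for the first-order Taylor remainder of the exponential. -/
theorem abs_exp_sub_one_sub_le {M d : ℝ} (hM : 1 ≤ M) (hd : Real.exp d ≤ M) :
    |Real.exp d - 1 - d| ≤ M * d ^ 2 := by
  have h1 := Real.add_one_le_exp d
  have h2 := Real.add_one_le_exp (-d)
  have h3 : Real.exp (-d) * Real.exp d = 1 := by rw [← Real.exp_add]; simp
  have h4 := Real.exp_pos d
  have h5 : Real.exp d - 1 ≤ d * Real.exp d := by nlinarith
  rw [abs_of_nonneg (by linarith)]
  rcases le_total 0 d with h | h
  · nlinarith [mul_le_mul_of_nonneg_left hd (sq_nonneg d)]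
  · nlinarith [mul_le_mul_of_nonneg_right hM (sq_nonneg d)]

theorem abs_exp_sub_one_le_mul {M d : ℝ} (hM : 1 ≤ M) (hd : Real.exp d ≤ M) :
    |Real.exp d - 1| ≤ M * |d| := by
  have h1 := Real.add_one_le_exp d
  have h2 := Real.add_one_le_exp (-d)
  have h3 : Real.exp (-d) * Real.exp d = 1 := by rw [← Real.exp_add]; simp
  have h4 := Real.exp_pos d
  have h5 : Real.exp d - 1 ≤ d * Real.exp d := by nlinarith
  rcases le_total 0 d with h | h
  · rw [abs_of_nonneg h, abs_of_nonneg (by linarith)]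
    nlinarith [mul_le_mul_of_nonneg_left hd h]
  · rw [abs_of_nonpos h, abs_of_nonpos (by nlinarith)]
    nlinarith

theorem div_one_sub_mul_div_le {c c' a b : ℝ} (hc : 0 < c) (hc' : 0 < c')
    (ha : c ≤ a) (ha1 : a ≤ 1 - c) (hb : c' ≤ b) (hb1 : b ≤ 1 - c') :
    (1 - a) / a * (b / (1 - b)) ≤ 1 / (c * c') := by
  rw [div_mul_div_comm]
  apply div_le_div₀ zero_le_one _ (by positivity)
  · exact mul_le_mul ha (by linarith) hc'.le (by linarith)
  · nlinarith

theorem logistic_sub_div {u v : ℝ} :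
    (1 / (1 + Real.exp (-v)) - 1 / (1 + Real.exp (-u)))
      / (1 / (1 + Real.exp (-v)) * (1 - 1 / (1 + Real.exp (-v))))
      = 1 / (1 + Real.exp (-u)) / (1 / (1 + Real.exp (-v))) * (Real.exp (v - u) - 1) := by
  have hw := Real.exp_pos (-v)
  have hE := Real.exp_pos (v - u)
  have hu : Real.exp (-u) = Real.exp (-v) * Real.exp (v - u) := by
    rw [← Real.exp_add]; congr 1; ring
  rw [hu]
  generalize Real.exp (-v) = w at *
  generalize Real.exp (v - u) = E at *
  have h : 1 - 1 / (1 + w) = w / (1 + w) := by field_simp; ring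
  rw [h]
  field_simp
  ring

set_option maxHeartbeats 1000000 in
/-- The linearization error of one inverse-propensity-weighted summand is quadratic in the
error of the logistic index. -/
theorem abs_ipw_summand_sub_linear_le {c c' : ℝ} (hc : 0 < c) (hc' : 0 < c')
    (hc1' : c' ≤ 1) {u v a b t y m : ℝ} (ht : t = 0 ∨ t = 1)
    (ha : a = 1 / (1 + Real.exp (-u))) (hb : b = 1 / (1 + Real.exp (-v)))
    (hac : c ≤ a) (hac1 : a ≤ 1 - c) (hbc : c' ≤ b) (hbc1 : b ≤ 1 - c') :
    |(t * y / (b * a) + (1 - t) * y / ((1 - b) * (1 - a)) - m / (b * (1 - b))) * (b - a)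
      - (v - u) * (t * y * (1 - b) / b + (1 - t) * y * b / (1 - b) - m)|
      ≤ 2 * (1 / (c * c')) / c' * (|y| + |m|) * (v - u) ^ 2 := by
  have ha0 : 0 < a := hc.trans_le hac
  have hb0 : 0 < b := hc'.trans_le hbc
  have ha1 : 0 < 1 - a := by linarith
  have hb1 : 0 < 1 - b := by linarith
  have hua : Real.exp (-u) = (1 - a) / a := by
    have := Real.exp_pos (-u); rw [ha]; field_simp; ring
  have hvb : Real.exp (-v) = (1 - b) / b := by
    have := Real.exp_pos (-v); rw [hb]; field_simp; ring
  have hE : Real.exp (v - u) = (1 - a) / a * (b / (1 - b)) := by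
    rw [show v - u = -u - -v by ring, Real.exp_sub, hua, hvb]; field_simp
  have hF : Real.exp (-(v - u)) = (1 - b) / b * (a / (1 - a)) := by
    rw [Real.exp_neg, hE]; field_simp
  set M := 1 / (c * c') with hMdef
  have hM : 1 ≤ M := by
    rw [hMdef, le_div_iff₀ (by positivity)]; nlinarith
  have hEM : Real.exp (v - u) ≤ M := by
    rw [hE]; exact div_one_sub_mul_div_le hc hc' hac hac1 hbc hbc1
  have hFM : Real.exp (-(v - u)) ≤ M := by
    rw [hF, hMdef, mul_comm c c']; exact div_one_sub_mul_div_le hc' hc hbc hbc1 hac hac1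
  have hmlin := logistic_sub_div (u := u) (v := v)
  rw [← ha, ← hb] at hmlin
  set d := v - u
  have hR := abs_exp_sub_one_sub_le hM hEM
  have hR' := abs_exp_sub_one_sub_le hM hFM
  have hL := abs_exp_sub_one_le_mul hM hEM
  rw [neg_sq] at hR'
  have hMc : M ≤ M / c' := by rw [le_div_iff₀ hc']; nlinarith
  have hbinv : 1 / b ≤ 1 / c' := one_div_le_one_div_of_le hc' hbc
  have hbinv' : 1 / (1 - b) ≤ 1 / c' := one_div_le_one_div_of_le hc' (by linarith)
  have hcpos : 0 < 1 / c' := by positivity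
  have hq : 0 ≤ M * d ^ 2 := by positivity
  have hab : |a - b| ≤ M * |d| := by
    have : a - b = -(a * (1 - b) * (Real.exp d - 1)) := by
      rw [hE]; field_simp; ring
    rw [this, abs_neg, abs_mul, abs_of_pos (mul_pos ha0 hb1)]
    refine (mul_le_of_le_one_left (abs_nonneg _) ?_).trans hL
    nlinarith
  have hm : |(b - a) / (b * (1 - b)) - d| ≤ 2 * M / c' * d ^ 2 := by
    have h1 : (b - a) / (b * (1 - b)) - d
        = 1 / b * (a * (Real.exp d - 1 - d) + (a - b) * d) := by
      rw [hmlin]; field_simp; ring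
    have h2 : |a * (Real.exp d - 1 - d) + (a - b) * d| ≤ 2 * (M * d ^ 2) := by
      refine (abs_add_le _ _).trans ?_
      rw [abs_mul, abs_mul, abs_of_pos ha0]
      have h3 : a * |Real.exp d - 1 - d| ≤ M * d ^ 2 :=
        (mul_le_of_le_one_left (abs_nonneg _) (by linarith)).trans hR
      have h4 : |a - b| * |d| ≤ M * d ^ 2 := by
        rw [← sq_abs d]
        nlinarith [mul_le_mul_of_nonneg_right hab (abs_nonneg d)]
      linarith
    rw [h1, abs_mul, abs_of_pos (by positivity : 0 < 1 / b)]
    calc 1 / b * _ ≤ 1 / c' * (2 * (M * d ^ 2)) :=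
          mul_le_mul hbinv h2 (abs_nonneg _) hcpos.le
      _ = _ := by ring
  have hy : |(t / (b * a) + (1 - t) / ((1 - b) * (1 - a))) * (b - a)
      - d * (t * (1 - b) / b + (1 - t) * b / (1 - b))| ≤ 2 * M / c' * d ^ 2 := by
    have h0 : 1 / c' * (M * d ^ 2) ≤ 2 * M / c' * d ^ 2 := by
      have : 0 ≤ 1 / c' * (M * d ^ 2) := by positivity
      have : 2 * M / c' * d ^ 2 = 2 * (1 / c' * (M * d ^ 2)) := by ring
      linarith
    refine le_trans ?_ h0
    rcases ht with rfl | rfl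
    · have h1 : (0 / (b * a) + (1 - 0) / ((1 - b) * (1 - a))) * (b - a)
          - d * (0 * (1 - b) / b + (1 - 0) * b / (1 - b))
          = -(b / (1 - b) * (Real.exp (-d) - 1 - -d)) := by
        rw [hF]; field_simp; ring
      rw [h1, abs_neg, abs_mul, abs_of_pos (by positivity)]
      refine mul_le_mul (le_trans ?_ hbinv') hR' (abs_nonneg _) hcpos.le
      gcongr
      linarith
    · have h1 : (1 / (b * a) + (1 - 1) / ((1 - b) * (1 - a))) * (b - a)
          - d * (1 * (1 - b) / b + (1 - 1) * b / (1 - b))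
          = (1 - b) / b * (Real.exp d - 1 - d) := by
        rw [hE]; field_simp; ring
      rw [h1, abs_mul, abs_of_pos (by positivity)]
      refine mul_le_mul (le_trans ?_ hbinv) hR (abs_nonneg _) hcpos.le
      gcongr
      linarith
  have hsplit : (t * y / (b * a) + (1 - t) * y / ((1 - b) * (1 - a)) - m / (b * (1 - b)))
        * (b - a) - d * (t * y * (1 - b) / b + (1 - t) * y * b / (1 - b) - m)
      = y * ((t / (b * a) + (1 - t) / ((1 - b) * (1 - a))) * (b - a)
          - d * (t * (1 - b) / b + (1 - t) * b / (1 - b)))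
        - m * ((b - a) / (b * (1 - b)) - d) := by ring
  rw [hsplit]
  refine (abs_sub _ _).trans ?_
  rw [abs_mul, abs_mul]
  nlinarith [mul_le_mul_of_nonneg_left hy (abs_nonneg y),
    mul_le_mul_of_nonneg_left hm (abs_nonneg m)]

/-- Cauchy–Schwarz for empirical averages of `|f| * d ^ 2`. -/
theorem average_abs_mul_sq_le {ι : Type*} (S : Finset ι) {w : ℝ} (hw : 0 ≤ w)
    (f d : ι → ℝ) {A B : ℝ} (hf : w * ∑ i ∈ S, f i ^ 2 ≤ A)
    (hd : Real.sqrt (w * ∑ i ∈ S, d i ^ 4) ≤ B) :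
    w * ∑ i ∈ S, |f i| * d i ^ 2 ≤ Real.sqrt A * B := by
  have h1 := Real.sum_mul_le_sqrt_mul_sqrt S (fun i => |f i|) (fun i => d i ^ 2)
  simp only [sq_abs, ← pow_mul] at h1
  calc w * ∑ i ∈ S, |f i| * d i ^ 2
      ≤ w * (Real.sqrt (∑ i ∈ S, f i ^ 2) * Real.sqrt (∑ i ∈ S, d i ^ 4)) := by gcongr
    _ = Real.sqrt (w * ∑ i ∈ S, f i ^ 2) * Real.sqrt (w * ∑ i ∈ S, d i ^ 4) := by
        rw [Real.sqrt_mul hw, Real.sqrt_mul hw]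
        nth_rewrite 1 [← Real.mul_self_sqrt hw]
        ring
    _ ≤ Real.sqrt A * B :=
        mul_le_mul (Real.sqrt_le_sqrt hf) hd (Real.sqrt_nonneg _) (Real.sqrt_nonneg _)

/-- Hölder's inequality (`ℓ₁`–`ℓ∞`) for an empirical average of `(x i · δ) * r i`. -/
theorem abs_average_inner_mul_le {ι κ : Type*} [Fintype ι] [Fintype κ] (w : ℝ)
    (x : ι → κ → ℝ) (δ : κ → ℝ) (r : ι → ℝ) {B : ℝ}
    (h : ∀ j, |w * ∑ i, x i j * r i| ≤ B) :
    |w * ∑ i, (∑ j, x i j * δ j) * r i| ≤ (∑ j, |δ j|) * B := by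
  have h1 : w * ∑ i, (∑ j, x i j * δ j) * r i = ∑ j, δ j * (w * ∑ i, x i j * r i) := by
    simp only [Finset.sum_mul, Finset.mul_sum]
    rw [Finset.sum_comm]
    exact Finset.sum_congr rfl fun j _ => Finset.sum_congr rfl fun i _ => by ring
  rw [h1, Finset.sum_mul]
  refine (Finset.abs_sum_le_sum_abs _ _).trans (Finset.sum_le_sum fun j _ => ?_)
  rw [abs_mul]
  exact mul_le_mul_of_nonneg_left (h j) (abs_nonneg _)


/-- deterministic bound on the bias term `Q_A` of the debiased IPW estimator
under a logistic propensity model. -/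
theorem QA_bias_bound
    (cpi : ℝ) (hcpi : cpi ∈ Set.Ioo (0 : ℝ) (1 / 2))
    (cpih : ℝ) (hcpih : cpih ∈ Set.Ioc (0 : ℝ) (1 / 2))
    (cγ c1 c2 cμ cY : ℝ)
    (hcγ : 0 < cγ) (hc1 : 0 < c1) (hc2 : 0 < c2) (hcμ : 0 < cμ) (hcY : 0 < cY) :
    ∃ cδ1 : ℝ, 0 < cδ1 ∧
      ∀ (n p s : ℕ), 1 ≤ n → 2 ≤ p → 1 ≤ s →
      ∀ (x : Fin n → Fin p → ℝ) (γ γh : Fin p → ℝ) (T Y μh : Fin n → ℝ),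
      (∀ i, T i = 0 ∨ T i = 1) →
      ∀ (pi pih Yt : Fin n → ℝ),
      (∀ i, pi i = 1 / (1 + Real.exp (-(∑ j, x i j * γ j)))) →
      (∀ i, pih i = 1 / (1 + Real.exp (-(∑ j, x i j * γh j)))) →
      (∀ i, Yt i = T i * Y i * (1 - pih i) / pih i
          + (1 - T i) * Y i * pih i / (1 - pih i)) →
      -- (a) overlap for the true and estimated propensity scores
      (∀ i, cpi < pi i ∧ pi i < 1 - cpi) →
      (∀ i, cpih ≤ pih i ∧ pih i ≤ 1 - cpih) →
      -- (b) ℓ₁-accuracy of the propensity coefficient estimate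
      (∑ j, |γh j - γ j|) ≤ cγ * s * Real.sqrt (Real.log p / n) →
      -- (c) fourth-moment bound on the index estimation errors
      Real.sqrt ((1 / (n : ℝ)) * ∑ i, (∑ j, x i j * (γh j - γ j)) ^ 4)
        ≤ c1 * s * Real.log p / n →
      -- (d) the bias-correction constraint
      (∀ j, |(1 / (n : ℝ)) * ∑ i, x i j * (Yt i - μh i)|
        ≤ c2 * Real.sqrt (Real.log p / n)) →
      -- (e), (f) norm bounds
      (1 / (n : ℝ)) * ∑ i, (μh i) ^ 2 ≤ cμ →
      (1 / (n : ℝ)) * ∑ i, (Y i) ^ 2 ≤ cY →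
      |(-(1 / (n : ℝ))) * ∑ i, (T i * Y i / (pih i * pi i)
          + (1 - T i) * Y i / ((1 - pih i) * (1 - pi i))
          - μh i / (pih i * (1 - pih i))) * (pih i - pi i)|
        ≤ cδ1 * s * Real.log p / n := by
  obtain ⟨hcpi0, hcpi1⟩ := hcpi
  obtain ⟨hcpih0, hcpih1⟩ := hcpih
  set K := 2 * (1 / (cpi * cpih)) / cpih with hK
  have hK0 : 0 < K := by positivity
  refine ⟨cγ * c2 + K * (Real.sqrt cY * c1 + Real.sqrt cμ * c1), by positivity, ?_⟩
  intro n p s _ _ _ x γ γh T Y μh hT pi pih Yt hpi hpih hYt ha hah hb hc hd he hf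
  have hw : (0 : ℝ) ≤ 1 / (n : ℝ) := by positivity
  have hmain : |1 / (n : ℝ) * ∑ i, (∑ j, x i j * (γh j - γ j)) * (Yt i - μh i)|
      ≤ cγ * c2 * (s * Real.log p / n) := by
    refine (abs_average_inner_mul_le _ x (fun j => γh j - γ j) _ hd).trans ?_
    calc _ ≤ cγ * s * Real.sqrt (Real.log p / n) * (c2 * Real.sqrt (Real.log p / n)) := by
          gcongr
      _ = cγ * c2 * s * (Real.sqrt (Real.log p / n) * Real.sqrt (Real.log p / n)) := by ring
      _ = _ := by
          rw [Real.mul_self_sqrt (by positivity)]; ring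
  have hterm : ∀ i, |(T i * Y i / (pih i * pi i) + (1 - T i) * Y i / ((1 - pih i) * (1 - pi i))
        - μh i / (pih i * (1 - pih i))) * (pih i - pi i)
        - (∑ j, x i j * (γh j - γ j)) * (Yt i - μh i)|
      ≤ K * (|Y i| + |μh i|) * (∑ j, x i j * (γh j - γ j)) ^ 2 := by
    intro i
    have hdiff : ∑ j, x i j * (γh j - γ j) = ∑ j, x i j * γh j - ∑ j, x i j * γ j := by
      simp only [mul_sub, Finset.sum_sub_distrib]
    rw [hdiff, hYt i]
    exact abs_ipw_summand_sub_linear_le hcpi0 hcpih0 (by linarith) (hT i)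
      (hpi i) (hpih i) (ha i).1.le (ha i).2.le (hah i).1 (hah i).2
  have hY := average_abs_mul_sq_le Finset.univ hw Y _ hf hc
  have hμ := average_abs_mul_sq_le Finset.univ hw μh _ he hc
  have hrem : |1 / (n : ℝ) * ∑ i, ((T i * Y i / (pih i * pi i)
        + (1 - T i) * Y i / ((1 - pih i) * (1 - pi i))
        - μh i / (pih i * (1 - pih i))) * (pih i - pi i)
        - (∑ j, x i j * (γh j - γ j)) * (Yt i - μh i))|
      ≤ K * (Real.sqrt cY * (c1 * s * Real.log p / n)
        + Real.sqrt cμ * (c1 * s * Real.log p / n)) := by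
    rw [abs_mul, abs_of_nonneg hw]
    calc _ ≤ 1 / (n : ℝ) * ∑ i, K * (|Y i| + |μh i|) * (∑ j, x i j * (γh j - γ j)) ^ 2 := by
          gcongr
          exact (Finset.abs_sum_le_sum_abs _ _).trans (Finset.sum_le_sum fun i _ => hterm i)
      _ = K * (1 / (n : ℝ) * ∑ i, |Y i| * (∑ j, x i j * (γh j - γ j)) ^ 2
            + 1 / (n : ℝ) * ∑ i, |μh i| * (∑ j, x i j * (γh j - γ j)) ^ 2) := by
          rw [← mul_add, ← Finset.sum_add_distrib, mul_left_comm, Finset.mul_sum _ _ K]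
          simp only [add_mul, mul_assoc]
      _ ≤ _ := by gcongr
  rw [neg_mul, abs_neg]
  rw [Finset.sum_sub_distrib, mul_sub] at hrem
  calc _ ≤ _ := by
        simpa only [sub_add_cancel] using (abs_add_le _ _).trans (add_le_add hrem hmain)
    _ = _ := by ring
end
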